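/- Lipschitz continuity of the gradient of the regularized gap function: let X ⊆ ℝ^d be nonempty, compact and convex, let λ > 0, and let F : ℝ^d → ℝ^d be differentiable with F Lipschitz continuous on X and the derivative map x ↦ DF(x) Lipschitz continuous on X (in operator norm). For x ∈ ℝ^d set y_λ(x) = Proj_X(x − λF(x)), the unique nearest point of x − λF(x) in X. Then the mapping x ↦ F(x) + (DF(x))*(x − y_λ(x)) + (1/λ)(y_λ(x) − x), which is the gradient ∇g_λ of the regularized gap function g_λ(x) = sup_{y ∈ X} [⟨F(x), x − y⟩ − (1/(2λ))‖x − y‖²], is Lipschitz continuous on X; moreover y_λ is Lipschitz continuous on X. -/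

import Mathlib

noncomputable section

open Metric

/-- `ℝ^d` as a Euclidean space. -/
abbrev Ed (d : ℕ) := EuclideanSpace ℝ (Fin d)

/-- Variational inequality for a nearest point of a convex set. -/
theorem Convex.inner_le_zero_of_forall_dist_le {E : Type*} [NormedAddCommGroup E]
    [InnerProductSpace ℝ E] {X : Set E} (hX : Convex ℝ X) {u p : E} (hp : p ∈ X)
    (h : ∀ z ∈ X, dist p u ≤ dist z u) {w : E} (hw : w ∈ X) : inner ℝ (u - p) (w - p) ≤ 0 := by
  refine (norm_eq_iInf_iff_real_inner_le_zero hX hp).1 ?_ w hw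
  have : Nonempty X := ⟨⟨p, hp⟩⟩
  refine le_antisymm (le_ciInf fun z => ?_) ?_
  · simpa only [dist_eq_norm, norm_sub_rev] using h z z.2
  · exact ciInf_le ⟨0, Set.forall_mem_range.2 fun _ => norm_nonneg _⟩ (⟨p, hp⟩ : X)

/-- Nearest-point maps onto convex sets are nonexpansive. -/
theorem Convex.norm_sub_le_of_forall_dist_le {E : Type*} [NormedAddCommGroup E]
    [InnerProductSpace ℝ E] {X : Set E} (hX : Convex ℝ X) {u v p q : E} (hp : p ∈ X) (hq : q ∈ X)
    (hpu : ∀ z ∈ X, dist p u ≤ dist z u) (hqv : ∀ z ∈ X, dist q v ≤ dist z v) :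
    ‖p - q‖ ≤ ‖u - v‖ := by
  have h₁ := hX.inner_le_zero_of_forall_dist_le hp hpu hq
  have h₂ := hX.inner_le_zero_of_forall_dist_le hq hqv hp
  have h₃ : inner ℝ (u - v) (p - q) =
      ‖p - q‖ ^ 2 - inner ℝ (u - p) (q - p) - inner ℝ (v - q) (p - q) := by
    rw [← real_inner_self_eq_norm_sq, ← neg_sub p q, inner_neg_right, sub_neg_eq_add,
      ← inner_add_left, ← inner_sub_left]
    congr 1
    abel
  have h₄ := real_inner_le_norm (u - v) (p - q)
  nlinarith [norm_nonneg (p - q), norm_nonneg (u - v)]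

/-- Lipschitz continuity of the gradient of the regularized gap
function: if `F` and `DF` are Lipschitz on the nonempty compact convex set `X`, and
`y_λ(x)` is the projection of `x − λF(x)` onto `X`, then
`x ↦ F(x) + (DF(x))*(x − y_λ(x)) + (1/λ)(y_λ(x) − x)` (which is `∇g_λ`) is Lipschitz
on `X`, and so is `y_λ`. -/
theorem gap_gradient_lipschitz
    {d : ℕ} (X : Set (Ed d)) (F : Ed d → Ed d) (F' : Ed d → (Ed d →L[ℝ] Ed d))
    (lam CF CD : ℝ) (ylam : Ed d → Ed d)
    (hXne : X.Nonempty) (hXcpt : IsCompact X) (hXconv : Convex ℝ X)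
    (hlam : 0 < lam)
    (hF' : ∀ x, HasFDerivAt F (F' x) x)
    (hFlip : ∀ x ∈ X, ∀ y ∈ X, ‖F x - F y‖ ≤ CF * ‖x - y‖)
    (hDFlip : ∀ x ∈ X, ∀ y ∈ X, ‖F' x - F' y‖ ≤ CD * ‖x - y‖)
    (hproj : ∀ x : Ed d, ylam x ∈ X ∧
      ∀ z ∈ X, dist (ylam x) (x - lam • F x) ≤ dist z (x - lam • F x)) :
    (∃ K : ℝ, 0 ≤ K ∧ ∀ x ∈ X, ∀ y ∈ X,
      ‖(F x + ContinuousLinearMap.adjoint (F' x) (x - ylam x)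
          + (1 / lam) • (ylam x - x))
        - (F y + ContinuousLinearMap.adjoint (F' y) (y - ylam y)
          + (1 / lam) • (ylam y - y))‖ ≤ K * ‖x - y‖) ∧
    (∃ K' : ℝ, 0 ≤ K' ∧ ∀ x ∈ X, ∀ y ∈ X, ‖ylam x - ylam y‖ ≤ K' * ‖x - y‖) := by
  have hy : ∀ x ∈ X, ∀ y ∈ X, ‖ylam x - ylam y‖ ≤ (1 + lam * |CF|) * ‖x - y‖ := by
    intro x hx y hy
    have hF : ‖F x - F y‖ ≤ |CF| * ‖x - y‖ :=
      (hFlip x hx y hy).trans (by gcongr; exact le_abs_self CF)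
    calc ‖ylam x - ylam y‖ ≤ ‖(x - lam • F x) - (y - lam • F y)‖ :=
          hXconv.norm_sub_le_of_forall_dist_le (hproj x).1 (hproj y).1 (hproj x).2 (hproj y).2
      _ = ‖(x - y) - lam • (F x - F y)‖ := by congr 1; module
      _ ≤ ‖x - y‖ + lam * ‖F x - F y‖ := by
          simpa [norm_smul, abs_of_pos hlam] using norm_sub_le (x - y) (lam • (F x - F y))
      _ ≤ ‖x - y‖ + lam * (|CF| * ‖x - y‖) := by gcongr
      _ = (1 + lam * |CF|) * ‖x - y‖ := by ring
  refine ⟨?_, 1 + lam * |CF|, by positivity, hy⟩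
  have hD : ∀ x ∈ X, ∀ y ∈ X, ‖F' x - F' y‖ ≤ |CD| * ‖x - y‖ := fun x hx y hy =>
    (hDFlip x hx y hy).trans (by gcongr; exact le_abs_self CD)
  have hdiam : ∀ x ∈ X, ∀ y ∈ X, ‖x - y‖ ≤ diam X := fun x hx y hy => by
    simpa only [dist_eq_norm] using dist_le_diam_of_mem hXcpt.isBounded hx hy
  obtain ⟨x₀, hx₀⟩ := hXne
  set R := diam X
  have hR : 0 ≤ R := diam_nonneg
  set M := |CD| * R + ‖F' x₀‖
  have hM : ∀ x ∈ X, ‖F' x‖ ≤ M := fun x hx =>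
    calc ‖F' x‖ ≤ ‖F' x - F' x₀‖ + ‖F' x₀‖ := by simpa using norm_add_le (F' x - F' x₀) (F' x₀)
      _ ≤ |CD| * ‖x - x₀‖ + ‖F' x₀‖ := by gcongr; exact hD x hx x₀ hx₀
      _ ≤ |CD| * R + ‖F' x₀‖ := by gcongr; exact hdiam x hx x₀ hx₀
  have hM₀ : 0 ≤ M := by positivity
  set L := 1 + lam * |CF|
  refine ⟨|CF| + M * (1 + L) + |CD| * R + (1 / lam) * (1 + L), by positivity, fun x hx y hyX => ?_⟩
  have hF : ‖F x - F y‖ ≤ |CF| * ‖x - y‖ :=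
    (hFlip x hx y hyX).trans (by gcongr; exact le_abs_self CF)
  have hres : ‖(x - y) - (ylam x - ylam y)‖ ≤ (1 + L) * ‖x - y‖ :=
    (norm_sub_le _ _).trans (by linarith [hy x hx y hyX])
  have h₁ : ‖ContinuousLinearMap.adjoint (F' x) ((x - y) - (ylam x - ylam y))‖
      ≤ M * ((1 + L) * ‖x - y‖) := by
    refine (ContinuousLinearMap.le_opNorm _ _).trans ?_
    rw [LinearIsometryEquiv.norm_map]
    gcongr
    exact hM x hx
  have h₂ : ‖ContinuousLinearMap.adjoint (F' x - F' y) (y - ylam y)‖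
      ≤ (|CD| * ‖x - y‖) * R := by
    refine (ContinuousLinearMap.le_opNorm _ _).trans ?_
    rw [LinearIsometryEquiv.norm_map]
    gcongr
    · exact hD x hx y hyX
    · exact hdiam y hyX _ (hproj y).1
  have h₃ : ‖(1 / lam) • ((x - y) - (ylam x - ylam y))‖ ≤ (1 / lam) * ((1 + L) * ‖x - y‖) := by
    rw [norm_smul, Real.norm_of_nonneg (by positivity)]
    gcongr
  have hsplit : (F x + ContinuousLinearMap.adjoint (F' x) (x - ylam x) + (1 / lam) • (ylam x - x))
        - (F y + ContinuousLinearMap.adjoint (F' y) (y - ylam y) + (1 / lam) • (ylam y - y))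
      = (F x - F y) + ContinuousLinearMap.adjoint (F' x) ((x - y) - (ylam x - ylam y))
        + ContinuousLinearMap.adjoint (F' x - F' y) (y - ylam y)
        - (1 / lam) • ((x - y) - (ylam x - ylam y)) := by
    simp only [map_sub, sub_apply]
    module
  rw [hsplit]
  refine (norm_sub_le _ _).trans ((add_le_add_left norm_add₃_le _).trans ?_)
  linarith
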